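/- Let n ≥ 1, c ≥ 1, m, l ∈ {0, …, c}, and let (A₁, A₂; C₁, …, Cₙ), with A₁, A₂, C₁, …, Cₙ ∈ End(ℂᶜ), satisfy condition (P1). For k ∈ ℤ set c_k = cos(πk/(c+1)), s_k = sin(πk/(c+1)), and for j ∈ {m, l} set A_{1j} = c_jA₁ − s_jA₂, A_{2j} = s_jA₁ + c_jA₂. Assume A_{2m} is invertible and set B_m = A_{2m}⁻¹A_{1m}, E_m = (Σ_{q=1}^{n} binom(n−1, q−1) c_m^{n−q} s_m^{q−1} C_q) A_{2m}, and assume moreover det(c_{m−l}𝟏_c − s_{m−l}B_m) ≠ 0. Then: (i) A_{2l} = A_{2m}(c_{m−l}𝟏_c − s_{m−l}B_m), so A_{2l} is invertible; (ii) B_l := A_{2l}⁻¹A_{1l} = (c_{m−l}𝟏_c − s_{m−l}B_m)⁻¹(s_{m−l}𝟏_c + c_{m−l}B_m); (iii) E_l := (Σ_{q=1}^{n} binom(n−1, q−1) c_l^{n−q} s_l^{q−1} C_q) A_{2l} = (c_{m−l}𝟏_c − s_{m−l}B_m)ⁿ E_m. -/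

import Mathlib

open Matrix BigOperators

noncomputable section

/-- The space of `c × c` complex matrices, regarded as endomorphisms of `ℂ^c`. -/
abbrev Mat (c : ℕ) : Type := Matrix (Fin c) (Fin c) ℂ

/-- `cos (π x / (c+1))` as a complex number. -/
def cmC (c : ℕ) (x : ℝ) : ℂ := Complex.ofReal (Real.cos (Real.pi * x / (c + 1)))

/-- `sin (π x / (c+1))` as a complex number. -/
def smC (c : ℕ) (x : ℝ) : ℂ := Complex.ofReal (Real.sin (Real.pi * x / (c + 1)))

/-- Condition (P1): for `n = 1`, `A₁C₁A₂ = A₂C₁A₁`; for `n > 1`,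
`A₁C_q = A₂C_{q+1}` and `C_qA₁ = C_{q+1}A₂` for `q = 1, …, n-1`. -/
def CondP1 (n c : ℕ) (A1 A2 : Mat c) (C : ℕ → Mat c) : Prop :=
  if n = 1 then A1 * C 1 * A2 = A2 * C 1 * A1
  else ∀ q : ℕ, 1 ≤ q → q ≤ n - 1 →
    A1 * C q = A2 * C (q + 1) ∧ C q * A1 = C (q + 1) * A2

/-- Condition (P2): the pencil `A₁ + λ A₂` is regular. -/
def CondP2 (c : ℕ) (A1 A2 : Mat c) : Prop :=
  ∃ ν1 ν2 : ℂ, (ν1 • A1 + ν2 • A2).det ≠ 0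

/-- Condition (P3). -/
def CondP3 (n c : ℕ) (A1 A2 : Mat c) (C : ℕ → Mat c) (e : Fin c → ℂ) : Prop :=
  ∀ l1 l2 m1 m2 : ℂ, (l1, l2) ≠ (0, 0) → l1 ^ n * m1 + l2 ^ n * m2 = 0 →
    ¬ ∃ v : Fin c → ℂ, v ≠ 0 ∧
      (C 1 * A2).mulVec v = (-m1) • v ∧
      (C n * A1).mulVec v = ((-1 : ℂ) ^ n * m2) • v ∧
      e ⬝ᵥ v = 0 ∧
      (l2 • A1 + l1 • A2).mulVec v = 0

/-- Condition (T1): `[b₁, b₂] = 0`. -/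
def CondT1 (c : ℕ) (b1 b2 : Mat c) : Prop := b1 * b2 = b2 * b1

/-- Condition (T2): co-stability of the ADHM datum `(b₁, b₂, e)`. -/
def CondT2 (c : ℕ) (b1 b2 : Mat c) (e : Fin c → ℂ) : Prop :=
  ∀ z w : ℂ, ¬ ∃ v : Fin c → ℂ, v ≠ 0 ∧
    b1.mulVec v = z • v ∧ b2.mulVec v = w • v ∧ e ⬝ᵥ v = 0

/-- `A_{1m} = c_m A₁ - s_m A₂`. -/
def Amat1 (c : ℕ) (m : ℝ) (A1 A2 : Mat c) : Mat c := cmC c m • A1 - smC c m • A2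

/-- `A_{2m} = s_m A₁ + c_m A₂`. -/
def Amat2 (c : ℕ) (m : ℝ) (A1 A2 : Mat c) : Mat c := smC c m • A1 + cmC c m • A2

/-- `B_m = A_{2m}⁻¹ A_{1m}`. -/
def Bmat (c : ℕ) (m : ℝ) (A1 A2 : Mat c) : Mat c :=
  (Amat2 c m A1 A2)⁻¹ * Amat1 c m A1 A2

/-- `E_m = (∑_{q=1}^{n} binom(n-1, q-1) c_m^{n-q} s_m^{q-1} C_q) A_{2m}`. -/
def Emat (n c : ℕ) (m : ℝ) (A1 A2 : Mat c) (C : ℕ → Mat c) : Mat c :=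
  (∑ q ∈ Finset.Icc 1 n,
    (((n - 1).choose (q - 1) : ℂ) * cmC c m ^ (n - q) * smC c m ^ (q - 1)) • C q) *
    Amat2 c m A1 A2

/-- A sub-representation `(S₀, S₁)`: `A₁(S₀) ⊆ S₁`, `A₂(S₀) ⊆ S₁`,
and `C_q(S₁) ⊆ S₀` for `q = 1, …, n`. -/
def SubRep (n c : ℕ) (A1 A2 : Mat c) (C : ℕ → Mat c)
    (S0 S1 : Submodule ℂ (Fin c → ℂ)) : Prop :=
  (∀ v ∈ S0, A1.mulVec v ∈ S1 ∧ A2.mulVec v ∈ S1) ∧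
  (∀ v ∈ S1, ∀ q : ℕ, 1 ≤ q → q ≤ n → (C q).mulVec v ∈ S0)

/-- Condition (Q1): for `n = 1`, `A₁C₁A₂ = A₂C₁A₁`; for `n ≥ 2`,
`A₁C_q = A₂C_{q+1}` and `C_qA₁ + f_q∘e = C_{q+1}A₂` for `q = 1, …, n-1`. -/
def CondQ1 (n c : ℕ) (A1 A2 : Mat c) (C : ℕ → Mat c) (e : Fin c → ℂ)
    (f : ℕ → Fin c → ℂ) : Prop :=
  if n = 1 then A1 * C 1 * A2 = A2 * C 1 * A1
  else ∀ q : ℕ, 1 ≤ q → q ≤ n - 1 →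
    A1 * C q = A2 * C (q + 1) ∧ C q * A1 + vecMulVec (f q) e = C (q + 1) * A2

/-- Condition (Q2). -/
def CondQ2 (n c : ℕ) (A1 A2 : Mat c) (C : ℕ → Mat c) (e : Fin c → ℂ) : Prop :=
  ∀ S0 S1 : Submodule ℂ (Fin c → ℂ), SubRep n c A1 A2 C S0 S1 →
    (∀ v ∈ S0, e ⬝ᵥ v = 0) →
    Module.finrank ℂ S0 ≤ Module.finrank ℂ S1 ∧
    (Module.finrank ℂ S0 = Module.finrank ℂ S1 → S0 = ⊥ ∧ S1 = ⊥)

/-- Condition (Q3) (with the framing maps `f_i`): for every sub-representation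
containing all the `Im f_i`, `dim S₀ ≤ dim S₁`; for `n = 1` there are no `f`'s
and the condition applies to every sub-representation. -/
def CondQ3 (n c : ℕ) (A1 A2 : Mat c) (C : ℕ → Mat c)
    (f : ℕ → Fin c → ℂ) : Prop :=
  ∀ S0 S1 : Submodule ℂ (Fin c → ℂ), SubRep n c A1 A2 C S0 S1 →
    (∀ i : ℕ, 1 ≤ i → i ≤ n - 1 → f i ∈ S0) →
    Module.finrank ℂ S0 ≤ Module.finrank ℂ S1

theorem cmC_sub (c : ℕ) (x y : ℝ) :
    cmC c (x - y) = cmC c x * cmC c y + smC c x * smC c y := by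
  simp only [cmC, smC, mul_sub, sub_div, Real.cos_sub]
  push_cast
  rfl

theorem smC_sub (c : ℕ) (x y : ℝ) :
    smC c (x - y) = smC c x * cmC c y - cmC c x * smC c y := by
  simp only [cmC, smC, mul_sub, sub_div, Real.sin_sub]
  push_cast
  rfl

theorem cmC_sq_add_smC_sq (c : ℕ) (x : ℝ) : cmC c x * cmC c x + smC c x * smC c x = 1 := by
  rw [← cmC_sub, sub_self]
  simp [cmC]

theorem Amat2_eq_sub (c : ℕ) (x y : ℝ) (A1 A2 : Mat c) :
    Amat2 c y A1 A2 = cmC c (x - y) • Amat2 c x A1 A2 - smC c (x - y) • Amat1 c x A1 A2 := by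
  rw [cmC_sub, smC_sub, Amat2, Amat2, Amat1]
  match_scalars
  · linear_combination -smC c y * cmC_sq_add_smC_sq c x
  · linear_combination -cmC c y * cmC_sq_add_smC_sq c x

theorem Amat1_eq_add (c : ℕ) (x y : ℝ) (A1 A2 : Mat c) :
    Amat1 c y A1 A2 = smC c (x - y) • Amat2 c x A1 A2 + cmC c (x - y) • Amat1 c x A1 A2 := by
  rw [cmC_sub, smC_sub, Amat1, Amat2, Amat1]
  match_scalars
  · linear_combination -cmC c y * cmC_sq_add_smC_sq c x
  · linear_combination smC c y * cmC_sq_add_smC_sq c x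

section CoeffSum

variable {K R : Type*} [CommRing K] [Ring R] [Algebra K R]

/-- The linear map sending `X ^ k` to `D (k + 1)` for `k < n`, and to `0` for `k ≥ n`. -/
def coeffSum (n : ℕ) (D : ℕ → R) : Polynomial K →ₗ[K] R :=
  ∑ k ∈ Finset.range n, (Polynomial.lcoeff K k).smulRight (D (k + 1))

theorem coeffSum_apply (n : ℕ) (D : ℕ → R) (p : Polynomial K) :
    coeffSum n D p = ∑ k ∈ Finset.range n, p.coeff k • D (k + 1) := by
  simp [coeffSum]

theorem coeffSum_linear_pow {n : ℕ} (hn : 1 ≤ n) (D : ℕ → R) (a b : K) :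
    coeffSum n D ((Polynomial.C a + Polynomial.C b * Polynomial.X) ^ (n - 1)) =
      ∑ q ∈ Finset.Icc 1 n,
        (((n - 1).choose (q - 1) : K) * a ^ (n - q) * b ^ (q - 1)) • D q := by
  obtain ⟨N, rfl⟩ : ∃ N, n = N + 1 := ⟨n - 1, by omega⟩
  have hsum : ∀ f : ℕ → R,
      ∑ q ∈ Finset.Icc 1 (N + 1), f q = ∑ k ∈ Finset.range (N + 1), f (k + 1) := by
    intro f
    rw [Finset.range_eq_Ico, Finset.sum_Ico_add' f 0 (N + 1) 1]
    rfl
  rw [coeffSum_apply, hsum]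
  refine Finset.sum_congr rfl fun k hk => ?_
  have hk' : k ≤ N := by simpa [Nat.lt_succ_iff] using hk
  congr 1
  have hterm : ∀ j : ℕ,
      ((Polynomial.C b * Polynomial.X) ^ j * Polynomial.C a ^ (N - j) * (N.choose j : Polynomial K)) =
        Polynomial.C (b ^ j * a ^ (N - j) * (N.choose j : K)) * Polynomial.X ^ j := by
    intro j
    simp only [map_mul, map_pow, map_natCast]
    ring
  simp only [Nat.add_sub_cancel, Nat.add_sub_add_right]
  rw [add_comm, add_pow, Finset.sum_congr rfl fun j _ => hterm j, Polynomial.finsetSum_coeff]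
  simp only [Polynomial.coeff_C_mul_X_pow]
  rw [Finset.sum_ite_eq, if_pos hk]
  ring

theorem mul_coeffSum_eq {n : ℕ} {A1 A2 : R} {D : ℕ → R}
    (h : ∀ q, 1 ≤ q → q ≤ n - 1 → A1 * D q = A2 * D (q + 1))
    {p : Polynomial K} (hp : p.natDegree + 1 < n) :
    A1 * coeffSum n D p = A2 * coeffSum n D (Polynomial.X * p) := by
  obtain ⟨N, rfl⟩ : ∃ N, n = N + 1 := ⟨n - 1, by omega⟩
  rw [coeffSum_apply, coeffSum_apply, Finset.sum_range_succ, Finset.sum_range_succ',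
    Polynomial.coeff_eq_zero_of_natDegree_lt (by omega : p.natDegree < N)]
  simp only [Polynomial.coeff_X_mul, Polynomial.coeff_X_mul_zero, zero_smul, add_zero,
    Finset.mul_sum, mul_smul_comm]
  refine Finset.sum_congr rfl fun k hk => ?_
  rw [h (k + 1) (by omega) (by have := Finset.mem_range.mp hk; omega)]

theorem mul_coeffSum_linear_mul {n : ℕ} {A1 A2 : R} {D : ℕ → R}
    (h : ∀ q, 1 ≤ q → q ≤ n - 1 → A1 * D q = A2 * D (q + 1))
    {p : Polynomial K} (hp : p.natDegree + 1 < n) (a b a' b' : K) :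
    (b' • A1 + a' • A2) * coeffSum n D ((Polynomial.C a + Polynomial.C b * Polynomial.X) * p) =
      (b • A1 + a • A2) *
        coeffSum n D ((Polynomial.C a' + Polynomial.C b' * Polynomial.X) * p) := by
  have key := mul_coeffSum_eq h hp
  have expand : ∀ u v : K, coeffSum n D ((Polynomial.C u + Polynomial.C v * Polynomial.X) * p) =
      u • coeffSum n D p + v • coeffSum n D (Polynomial.X * p) := by
    intro u v
    rw [add_mul, mul_assoc, ← Polynomial.smul_eq_C_mul, ← Polynomial.smul_eq_C_mul, map_add,
      map_smul, map_smul]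
  rw [expand, expand]
  simp only [add_mul, mul_add, smul_mul_smul_comm, key]
  module

theorem coeffSum_linear_pow_mul {n : ℕ} {A1 A2 Y : R} {D : ℕ → R} {a b a' b' : K}
    (h : ∀ q, 1 ≤ q → q ≤ n - 1 → A1 * D q = A2 * D (q + 1))
    (hu : IsUnit (b • A1 + a • A2)) (hY : b' • A1 + a' • A2 = (b • A1 + a • A2) * Y) :
    ∀ i j : ℕ, i + j + 1 = n →
      coeffSum n D ((Polynomial.C a' + Polynomial.C b' * Polynomial.X) ^ i *
          (Polynomial.C a + Polynomial.C b * Polynomial.X) ^ j) =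
        Y ^ i * coeffSum n D ((Polynomial.C a + Polynomial.C b * Polynomial.X) ^ (n - 1)) := by
  intro i
  induction i with
  | zero =>
    rintro j rfl
    simp
  | succ i ih =>
    intro j hij
    have hdeg : ∀ (u v : K) (k : ℕ),
        ((Polynomial.C u + Polynomial.C v * Polynomial.X) ^ k).natDegree ≤ k := by
      intro u v k
      refine Polynomial.natDegree_pow_le_of_le k (m := 1) ?_ |>.trans (by simp)
      rw [add_comm]
      exact Polynomial.natDegree_linear_le
    have hp := Polynomial.natDegree_mul_le_of_le (hdeg a' b' i) (hdeg a b j)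
    have step := mul_coeffSum_linear_mul h (Nat.lt_of_le_of_lt (Nat.succ_le_succ hp) (by omega)) a b a' b'
    rw [hY, mul_assoc] at step
    rw [pow_succ' Y, mul_assoc, ← ih (j + 1) (by omega), pow_succ', mul_assoc, ← hu.mul_right_inj,
      ← step]
    congr 3
    ring

end CoeffSum

theorem CondP1.mul_succ {n c : ℕ} {A1 A2 : Mat c} {C : ℕ → Mat c} (h : CondP1 n c A1 A2 C)
    (q : ℕ) (hq : 1 ≤ q) (hqn : q ≤ n - 1) : A1 * C q = A2 * C (q + 1) := by
  rw [CondP1, if_neg (by omega)] at h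
  exact (h q hq hqn).1

theorem CondP1.mul_mul_comm {n c : ℕ} {A1 A2 : Mat c} {C : ℕ → Mat c} (h : CondP1 n c A1 A2 C)
    (q : ℕ) (hq : 1 ≤ q) (hqn : q ≤ n) : A1 * C q * A2 = A2 * C q * A1 := by
  rw [CondP1] at h
  split_ifs at h with hn
  · obtain rfl : q = 1 := by omega
    exact h
  · rcases hqn.eq_or_lt with rfl | hlt
    · obtain ⟨r, rfl⟩ : ∃ r, q = r + 1 := ⟨q - 1, by omega⟩
      obtain ⟨h1, h2⟩ := h r (by omega) (by omega)
      rw [mul_assoc, ← h2, ← mul_assoc, h1]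
    · obtain ⟨h1, h2⟩ := h q hq (by omega)
      rw [h1, mul_assoc, ← h2, ← mul_assoc]

theorem CondP1.Amat2_mul_coeffSum_mul_comm {n c : ℕ} {A1 A2 : Mat c} {C : ℕ → Mat c}
    (h : CondP1 n c A1 A2 C) (x y : ℝ) (p : Polynomial ℂ) :
    Amat2 c x A1 A2 * coeffSum n C p * Amat2 c y A1 A2 =
      Amat2 c y A1 A2 * coeffSum n C p * Amat2 c x A1 A2 := by
  have key : A1 * coeffSum n C p * A2 = A2 * coeffSum n C p * A1 := by
    simp only [coeffSum_apply, Finset.mul_sum, Finset.sum_mul, mul_smul_comm, smul_mul_assoc]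
    refine Finset.sum_congr rfl fun k hk => ?_
    rw [h.mul_mul_comm (k + 1) (by omega) (Finset.mem_range.mp hk)]
  simp only [Amat2, add_mul, mul_add, smul_mul_assoc, mul_smul_comm, key]
  module

theorem Emat_eq_coeffSum {n : ℕ} (hn : 1 ≤ n) (c : ℕ) (x : ℝ) (A1 A2 : Mat c) (C : ℕ → Mat c) :
    Emat n c x A1 A2 C = coeffSum n C ((Polynomial.C (cmC c x) +
      Polynomial.C (smC c x) * Polynomial.X) ^ (n - 1)) * Amat2 c x A1 A2 := by
  rw [coeffSum_linear_pow hn, Emat]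

/-- the transition identities between the local ADHM data
`(B_m, E_m)` and `(B_l, E_l)`. -/
theorem stmt_9 (n c m l : ℕ) (hn : 1 ≤ n) (hc : 1 ≤ c) (hm : m ≤ c) (hl : l ≤ c)
    (A1 A2 : Mat c) (C : ℕ → Mat c) (hP1 : CondP1 n c A1 A2 C)
    (hinv : IsUnit (Amat2 c m A1 A2))
    (hdet : (cmC c ((m : ℝ) - l) • (1 : Mat c) -
        smC c ((m : ℝ) - l) • Bmat c m A1 A2).det ≠ 0) :
    Amat2 c l A1 A2 =
      Amat2 c m A1 A2 *
        (cmC c ((m : ℝ) - l) • (1 : Mat c) - smC c ((m : ℝ) - l) • Bmat c m A1 A2) ∧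
    IsUnit (Amat2 c l A1 A2) ∧
    Bmat c l A1 A2 =
      (cmC c ((m : ℝ) - l) • (1 : Mat c) - smC c ((m : ℝ) - l) • Bmat c m A1 A2)⁻¹ *
        (smC c ((m : ℝ) - l) • (1 : Mat c) + cmC c ((m : ℝ) - l) • Bmat c m A1 A2) ∧
    Emat n c l A1 A2 C =
      (cmC c ((m : ℝ) - l) • (1 : Mat c) - smC c ((m : ℝ) - l) • Bmat c m A1 A2) ^ n *
        Emat n c m A1 A2 C := by
  set B := Bmat c m A1 A2 with hB
  set x : ℝ := (m : ℝ) - l with hx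
  set Y : Mat c := cmC c x • 1 - smC c x • B with hY
  have hdetm : IsUnit (Amat2 c m A1 A2).det := (Matrix.isUnit_iff_isUnit_det _).mp hinv
  have hA1m : Amat1 c m A1 A2 = Amat2 c m A1 A2 * B := by
    rw [hB, Bmat, Matrix.mul_nonsing_inv_cancel_left _ _ hdetm]
  have hA2l : Amat2 c l A1 A2 = Amat2 c m A1 A2 * Y := by
    rw [Amat2_eq_sub c m l, hA1m, hY, mul_sub, mul_smul_comm, mul_smul_comm, mul_one]
  have hYunit : IsUnit Y := (Matrix.isUnit_iff_isUnit_det _).mpr hdet.isUnit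
  refine ⟨hA2l, hA2l ▸ hinv.mul hYunit, ?_, ?_⟩
  · have hA1l : Amat1 c l A1 A2 = Amat2 c m A1 A2 * (smC c x • 1 + cmC c x • B) := by
      rw [Amat1_eq_add c m l, hA1m, mul_add, mul_smul_comm, mul_smul_comm, mul_one]
    rw [Bmat, hA1l, hA2l, Matrix.mul_inv_rev, mul_assoc,
      Matrix.nonsing_inv_mul_cancel_left _ _ hdetm]
  · have hpow := coeffSum_linear_pow_mul hP1.mul_succ hinv hA2l (n - 1) 0 (by omega)
    rw [pow_zero, mul_one] at hpow
    have hcomm : ∀ p : Polynomial ℂ, coeffSum n C p * Amat2 c l A1 A2 =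
        Y * (coeffSum n C p * Amat2 c m A1 A2) := by
      intro p
      rw [← hinv.mul_right_inj, ← mul_assoc, ← mul_assoc, ← hA2l,
        hP1.Amat2_mul_coeffSum_mul_comm m l p, mul_assoc]
    rw [Emat_eq_coeffSum hn, Emat_eq_coeffSum hn, hpow, mul_assoc, hcomm, ← mul_assoc,
      ← pow_succ, Nat.sub_add_cancel hn]
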